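/- Poincaré inequality for polynomial images of convex bodies: there exists a constant C(d, n) > 0, depending only on d and n, such that for every convex compact set K ⊂ ℝ^n of positive volume, every polynomial f of degree at most d on ℝ^n with α_f > 0, and every smooth function φ : ℝ → ℝ, one has ‖φ − ∫ φ dμ_f‖_{L²(μ_f)} ≤ C(d, n) · α_f · ‖φ′‖_{L²(μ_f)}, where μ_f = λ_K ∘ f^{−1}. -/

import Mathlib

open MeasureTheory

/-- `f` is a polynomial of degree at most `d` on `ℝ^n`. -/
def IsPolyDeg {n : ℕ} (d : ℕ) (f : EuclideanSpace ℝ (Fin n) → ℝ) : Prop :=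
  ∃ p : MvPolynomial (Fin n) ℝ, p.totalDegree ≤ d ∧
    ∀ x, f x = MvPolynomial.eval (fun i => x i) p

/-- The normalized Lebesgue measure (uniform distribution) on a set `K ⊂ ℝ^n`. -/
noncomputable def unifOn {n : ℕ} (K : Set (EuclideanSpace ℝ (Fin n))) :
    Measure (EuclideanSpace ℝ (Fin n)) :=
  (volume K)⁻¹ • volume.restrict K

lemma pp_dilate {n : ℕ} {K : Set (EuclideanSpace ℝ (Fin n))} (hK : Convex ℝ K)
    (hKc : IsCompact K) {y : EuclideanSpace ℝ (Fin n)} (hy : y ∈ K) {s : ℝ} (hs0 : 0 < s)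
    (hs1 : s ≤ 1) (g : EuclideanSpace ℝ (Fin n) → ENNReal) (hg : Measurable g) :
    ∫⁻ x, g (y + s • (x - y)) ∂(unifOn K) ≤ ENNReal.ofReal ((s ^ n)⁻¹) * ∫⁻ x, g x ∂(unifOn K) := by
  unfold unifOn
  rw [lintegral_smul_measure, lintegral_smul_measure, smul_eq_mul, smul_eq_mul,
    mul_left_comm]
  gcongr
  have hm : MeasurableSet K := hKc.isClosed.measurableSet
  rw [← lintegral_indicator hm, ← lintegral_indicator hm]
  calc ∫⁻ x, K.indicator (fun x => g (y + s • (x - y))) x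
      ≤ ∫⁻ x, K.indicator g (s • x + (y - s • y)) := by
        apply lintegral_mono
        intro x
        by_cases hx : x ∈ K
        · have h1 : y + s • (x - y) ∈ K := hK.add_smul_sub_mem hy hx ⟨hs0.le, hs1⟩
          have h2 : s • x + (y - s • y) = y + s • (x - y) := by rw [smul_sub]; abel
          simp only [Set.indicator_of_mem hx]
          rw [h2, Set.indicator_of_mem h1]
        · simp [Set.indicator_of_notMem hx]
    _ = ∫⁻ z, K.indicator g (z + (y - s • y)) ∂(Measure.map (s • ·) volume) := by
        rw [lintegral_map]
        · exact (hg.indicator hm).comp (measurable_id.add_const _)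
        · exact measurable_const_smul s
    _ = ENNReal.ofReal ((s ^ n)⁻¹) * ∫⁻ x, K.indicator g x := by
        rw [Measure.map_addHaar_smul _ hs0.ne', lintegral_smul_measure,
          lintegral_add_right_eq_self]
        simp [abs_of_pos hs0]

lemma pp_prob {n : ℕ} {K : Set (EuclideanSpace ℝ (Fin n))} (hKc : IsCompact K)
    (h0 : volume K ≠ 0) : IsProbabilityMeasure (unifOn K) := by
  constructor
  simp [unifOn]
  exact ENNReal.inv_mul_cancel h0 hKc.measure_lt_top.ne

lemma pp_ae {n : ℕ} {K : Set (EuclideanSpace ℝ (Fin n))} (hKc : IsCompact K) :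
    ∀ᵐ x ∂(unifOn K), x ∈ K := by
  unfold unifOn
  exact Measure.ae_smul_measure (ae_restrict_mem hKc.isClosed.measurableSet) _

lemma pp_int {n : ℕ} {K : Set (EuclideanSpace ℝ (Fin n))} (hKc : IsCompact K)
    (h0 : volume K ≠ 0) {g : EuclideanSpace ℝ (Fin n) → ℝ} (hg : Continuous g) :
    Integrable g (unifOn K) := by
  unfold unifOn
  exact Integrable.smul_measure (hg.continuousOn.integrableOn_compact hKc) (by simpa using h0)

lemma pp_dilate_real {n : ℕ} {K : Set (EuclideanSpace ℝ (Fin n))} (hK : Convex ℝ K)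
    (hKc : IsCompact K) (h0 : volume K ≠ 0) {y : EuclideanSpace ℝ (Fin n)} (hy : y ∈ K)
    {s : ℝ} (hs0 : 0 < s) (hs1 : s ≤ 1) (g : EuclideanSpace ℝ (Fin n) → ℝ)
    (hg : Continuous g) (hg0 : ∀ x, 0 ≤ g x) :
    ∫ x, g (y + s • (x - y)) ∂(unifOn K) ≤ (s ^ n)⁻¹ * ∫ x, g x ∂(unifOn K) := by
  have h := pp_dilate hK hKc hy hs0 hs1 (fun x => ENNReal.ofReal (g x)) hg.measurable.ennreal_ofReal
  have hg' : Continuous fun x => g (y + s • (x - y)) := by fun_prop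
  rw [← ofReal_integral_eq_lintegral_ofReal (pp_int hKc h0 hg) (ae_of_all _ hg0),
    ← ofReal_integral_eq_lintegral_ofReal (pp_int hKc h0 hg') (ae_of_all _ fun x => hg0 _),
    ← ENNReal.ofReal_mul (by positivity)] at h
  exact (ENNReal.ofReal_le_ofReal_iff
    (mul_nonneg (by positivity) (integral_nonneg hg0))).1 h

/-- interpolation nodes -/
noncomputable def ppNode (d : ℕ) (i : ℕ) : ℝ := ((i : ℝ) + 1) / ((d : ℝ) + 1)

lemma ppNode_pos (d i : ℕ) : 0 < ppNode d i := by unfold ppNode; positivity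

lemma ppNode_le {d i : ℕ} (h : i ∈ Finset.range (d + 1)) : ppNode d i ≤ 1 := by
  unfold ppNode
  rw [div_le_one (by positivity)]
  have : i ≤ d := by simpa [Nat.lt_succ_iff] using h
  exact_mod_cast Nat.succ_le_succ this

lemma ppNode_inj (d : ℕ) : Function.Injective (ppNode d) := by
  intro i j h
  unfold ppNode at h
  field_simp at h
  simpa using h

open Polynomial in
lemma pp_lagrange (d : ℕ) : ∃ C : ℝ, 0 < C ∧ ∀ p : ℝ[X], p.natDegree ≤ d →
    |p.eval 0| ≤ C * ∑ i ∈ Finset.range (d + 1), |p.eval (ppNode d i)| ∧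
    ∀ t ∈ Set.Icc (0 : ℝ) 1,
      |p.derivative.eval t| ≤ C * ∑ i ∈ Finset.range (d + 1), |p.eval (ppNode d i)| := by
  set L : ℕ → ℝ[X] := fun i => Lagrange.basis (Finset.range (d + 1)) (ppNode d) i with hL
  have hb : ∀ i, ∃ c : ℝ, ∀ t ∈ Set.Icc (0 : ℝ) 1, ‖(L i).derivative.eval t‖ ≤ c := fun i =>
    isCompact_Icc.exists_bound_of_continuousOn (L i).derivative.continuous.continuousOn
  choose c hc using hb
  set C : ℝ := 1 + ∑ i ∈ Finset.range (d + 1), (|(L i).eval 0| + |c i|) with hC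
  have hle : ∀ i ∈ Finset.range (d + 1), |(L i).eval 0| + |c i| ≤ C := by
    intro i hi
    have := Finset.single_le_sum (f := fun i => |(L i).eval 0| + |c i|)
      (fun i _ => by positivity) hi

    linarith
  refine ⟨C, by positivity, fun p hp => ?_⟩
  have hpL : p = ∑ i ∈ Finset.range (d + 1), Polynomial.C (p.eval (ppNode d i)) * L i := by
    have := Lagrange.eq_interpolate (s := Finset.range (d + 1)) (v := ppNode d) (f := p)
      ((ppNode_inj d).injOn) (by
        rw [Finset.card_range]
        exact lt_of_le_of_lt Polynomial.degree_le_natDegree (by exact_mod_cast Nat.lt_succ_of_le hp))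
    rw [Lagrange.interpolate_apply] at this
    exact this
  constructor
  · have : p.eval 0 = ∑ i ∈ Finset.range (d + 1), p.eval (ppNode d i) * (L i).eval 0 := by
      conv_lhs => rw [hpL]
      simp [Polynomial.eval_finsetSum]
    rw [this, Finset.mul_sum]
    refine (Finset.abs_sum_le_sum_abs _ _).trans (Finset.sum_le_sum fun i hi => ?_)
    rw [abs_mul, mul_comm]
    gcongr
    have := hle i hi
    have := abs_nonneg (c i)
    linarith
  · intro t ht
    have : p.derivative.eval t =
        ∑ i ∈ Finset.range (d + 1), p.eval (ppNode d i) * (L i).derivative.eval t := by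
      conv_lhs => rw [hpL]
      simp [Polynomial.eval_finsetSum]
    rw [this, Finset.mul_sum]
    refine (Finset.abs_sum_le_sum_abs _ _).trans (Finset.sum_le_sum fun i hi => ?_)
    rw [abs_mul, mul_comm]
    gcongr
    have h1 := hle i hi
    have h2 := hc i t ht
    rw [Real.norm_eq_abs] at h2
    have := abs_nonneg ((L i).eval 0)
    have := le_abs_self (c i)
    linarith

open Polynomial in
lemma pp_line {n d : ℕ} {f : EuclideanSpace ℝ (Fin n) → ℝ} (hf : IsPolyDeg d f) (m : ℝ)
    (x v : EuclideanSpace ℝ (Fin n)) :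
    ∃ q : ℝ[X], q.natDegree ≤ d ∧ ∀ t : ℝ, q.eval t = f (x + t • v) - m := by
  obtain ⟨p, hp, hpf⟩ := hf
  refine ⟨MvPolynomial.aeval (fun i => C (v i) * X + C (x i)) p - C m, ?_, fun t => ?_⟩
  · have := MvPolynomial.aeval_natDegree_le p hp (fun i => C (v i) * X + C (x i)) (n := 1)
      (fun i => natDegree_linear_le)
    rw [natDegree_sub_C]
    simpa using this
  · rw [eval_sub, eval_C, hpf]
    congr 1
    rw [← Polynomial.coe_evalRingHom, MvPolynomial.aeval_def, MvPolynomial.hom_eval₂,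
      MvPolynomial.eval, MvPolynomial.coe_eval₂Hom]
    congr 1
    · ext; simp
    · funext i; simp; ring

lemma pp_cont {n d : ℕ} {f : EuclideanSpace ℝ (Fin n) → ℝ} (hf : IsPolyDeg d f) :
    Continuous f := by
  obtain ⟨p, hp, hpf⟩ := hf
  have : f = fun x => MvPolynomial.eval (fun i => x i) p := funext hpf
  rw [this]
  exact (MvPolynomial.continuous_eval p).comp (by fun_prop)

lemma pp_remez (d n : ℕ) : ∃ C : ℝ, 0 < C ∧
    ∀ K : Set (EuclideanSpace ℝ (Fin n)), Convex ℝ K → IsCompact K → volume K ≠ 0 →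
      ∀ f : EuclideanSpace ℝ (Fin n) → ℝ, IsPolyDeg d f → ∀ m : ℝ, ∀ y ∈ K,
        |f y - m| ≤ C * ∫ x, |f x - m| ∂(unifOn K) := by
  obtain ⟨C, hC, hL⟩ := pp_lagrange d
  refine ⟨C * ∑ i ∈ Finset.range (d + 1), (ppNode d i ^ n)⁻¹, ?_, ?_⟩
  · refine mul_pos hC (Finset.sum_pos (fun i _ => ?_) ⟨0, by simp⟩)
    have := ppNode_pos d i
    positivity
  intro K hK hKc h0 f hf m y hy
  have hfc := pp_cont hf
  have := pp_prob hKc h0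
  have hpt : ∀ x, |f y - m| ≤
      C * ∑ i ∈ Finset.range (d + 1), |f (y + ppNode d i • (x - y)) - m| := by
    intro x
    obtain ⟨q, hq, hqe⟩ := pp_line hf m y (x - y)
    have := (hL q hq).1
    simpa [hqe] using this
  have hci : ∀ i, Continuous fun x => |f (y + ppNode d i • (x - y)) - m| := by
    intro i; fun_prop
  have h1 : ∫ _x, |f y - m| ∂(unifOn K) ≤ ∫ x, C * ∑ i ∈ Finset.range (d + 1),
      |f (y + ppNode d i • (x - y)) - m| ∂(unifOn K) := by
    refine integral_mono (integrable_const _) (pp_int hKc h0 ?_) hpt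
    exact continuous_const.mul (continuous_finsetSum _ fun i _ => hci i)
  rw [integral_const, probReal_univ, one_smul, integral_const_mul,
    integral_finsetSum _ (fun i _ => pp_int hKc h0 (hci i))] at h1
  refine h1.trans ?_
  rw [mul_assoc, Finset.sum_mul]
  gcongr with i hi
  exact pp_dilate_real hK hKc h0 hy (ppNode_pos d i) (ppNode_le hi) (fun x => |f x - m|)
    (by fun_prop) (fun x => abs_nonneg _)

/-- Derivative along segments is bounded by the mean deviation. -/
lemma pp_markov (d n : ℕ) : ∃ C : ℝ, 0 < C ∧
    ∀ K : Set (EuclideanSpace ℝ (Fin n)), Convex ℝ K → IsCompact K → volume K ≠ 0 →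
      ∀ f : EuclideanSpace ℝ (Fin n) → ℝ, IsPolyDeg d f → ∀ m : ℝ, ∀ x ∈ K, ∀ w ∈ K,
        ∃ q : Polynomial ℝ, (∀ t : ℝ, q.eval t = f (x + t • (w - x))) ∧
        ∀ t ∈ Set.Icc (0 : ℝ) 1,
          |q.derivative.eval t| ≤ C * ∫ x, |f x - m| ∂(unifOn K) := by
  obtain ⟨C, hC, hL⟩ := pp_lagrange d
  obtain ⟨C', hC', hR⟩ := pp_remez d n
  refine ⟨C * ((d + 1) * C'), by positivity, ?_⟩
  intro K hK hKc h0 f hf m x hx w hw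
  obtain ⟨q, hq, hqe⟩ := pp_line hf m x (w - x)
  refine ⟨q + Polynomial.C m, fun t => by simp [hqe], fun t ht => ?_⟩
  have h := (hL q hq).2 t ht
  simp only [Polynomial.derivative_add, Polynomial.derivative_C, add_zero]
  refine h.trans ?_
  rw [mul_assoc, mul_assoc]
  gcongr
  have : ∀ i ∈ Finset.range (d + 1),
      |q.eval (ppNode d i)| ≤ C' * ∫ x, |f x - m| ∂(unifOn K) := by
    intro i hi
    rw [hqe]
    exact hR K hK hKc h0 f hf m _
      (hK.add_smul_sub_mem hx hw ⟨(ppNode_pos d i).le, ppNode_le hi⟩)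
  refine (Finset.sum_le_card_nsmul _ _ _ this).trans ?_
  simp

lemma pp_cs (u : ℝ → ℝ) (hu : Continuous u) :
    (∫ t in (0:ℝ)..1, u t) ^ 2 ≤ ∫ t in (0:ℝ)..1, u t ^ 2 := by
  set a := ∫ t in (0:ℝ)..1, u t with ha
  have h : 0 ≤ ∫ t in (0:ℝ)..1, (u t - a) ^ 2 :=
    intervalIntegral.integral_nonneg (by norm_num) fun t _ => sq_nonneg _
  have h2 : ∫ t in (0:ℝ)..1, (u t - a) ^ 2 = (∫ t in (0:ℝ)..1, u t ^ 2) - a ^ 2 := by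
    have : ∀ t, (u t - a) ^ 2 = u t ^ 2 - (2 * a) * u t + a ^ 2 := fun t => by ring
    simp_rw [this]
    rw [intervalIntegral.integral_add, intervalIntegral.integral_sub,
      intervalIntegral.integral_const_mul, ← ha]
    · simp; ring
    all_goals exact Continuous.intervalIntegrable (by fun_prop) _ _
  linarith

lemma pp_path {n : ℕ} {f : EuclideanSpace ℝ (Fin n) → ℝ} {φ : ℝ → ℝ}
    (hφ : ContDiff ℝ 1 φ)
    (x w : EuclideanSpace ℝ (Fin n)) (q : Polynomial ℝ) (M : ℝ)
    (hq : ∀ t : ℝ, q.eval t = f (x + t • (w - x)))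
    (hM : ∀ t ∈ Set.Icc (0 : ℝ) 1, |q.derivative.eval t| ≤ M) :
    (φ (f x) - φ (f w)) ^ 2 ≤ M ^ 2 * ∫ t in (0:ℝ)..1, deriv φ (f (x + t • (w - x))) ^ 2 := by
  have hd : Continuous (deriv φ) := hφ.continuous_deriv le_rfl
  have hder : ∀ t : ℝ, HasDerivAt (fun t => φ (q.eval t))
      (deriv φ (q.eval t) * q.derivative.eval t) t := fun t =>
    ((hφ.differentiable (by norm_num)).differentiableAt.hasDerivAt).comp t (q.hasDerivAt t)
  have hqc : Continuous fun t => q.eval t := q.continuous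
  have hqc' : Continuous fun t => q.derivative.eval t := q.derivative.continuous
  have hint := intervalIntegral.integral_eq_sub_of_hasDerivAt (a := 0) (b := 1)
    (fun t _ => hder t) (Continuous.intervalIntegrable (by fun_prop) _ _)
  have e0 : q.eval 0 = f x := by simp [hq]
  have e1 : q.eval 1 = f w := by simp [hq]
  rw [e0, e1] at hint
  have := pp_cs (fun t => deriv φ (q.eval t) * q.derivative.eval t) (by fun_prop)
  rw [hint] at this
  rw [← neg_sub, neg_sq]
  refine this.trans ?_
  rw [← intervalIntegral.integral_const_mul]
  simp_rw [← hq]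
  refine intervalIntegral.integral_mono_on (by norm_num)
    (Continuous.intervalIntegrable (by fun_prop) _ _)
    (Continuous.intervalIntegrable (by fun_prop) _ _) fun t ht => ?_
  rw [mul_pow, mul_comm]
  have := hM t ht
  have : q.derivative.eval t ^ 2 ≤ M ^ 2 := sq_le_sq' (by linarith [abs_le.1 this]) (abs_le.1 this).2
  gcongr

lemma pp_half {n : ℕ} {K : Set (EuclideanSpace ℝ (Fin n))} (hK : Convex ℝ K)
    (hKc : IsCompact K) (h0 : volume K ≠ 0) {f : EuclideanSpace ℝ (Fin n) → ℝ}
    (hf : Continuous f) {φ : ℝ → ℝ} (hφ : ContDiff ℝ 1 φ) (M : ℝ)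
    (hM : ∀ x ∈ K, ∀ w ∈ K, ∃ q : Polynomial ℝ, (∀ t : ℝ, q.eval t = f (x + t • (w - x))) ∧
        ∀ t ∈ Set.Icc (0 : ℝ) 1, |q.derivative.eval t| ≤ M)
    {y : EuclideanSpace ℝ (Fin n)} (hy : y ∈ K) :
    ∫⁻ x, ENNReal.ofReal ((φ (f x) - φ (f ((1 / 2 : ℝ) • (x + y)))) ^ 2) ∂(unifOn K) ≤
      ENNReal.ofReal (2 ^ n * M ^ 2 * ∫ x, deriv φ (f x) ^ 2 ∂(unifOn K)) := by
  have hd : Continuous (deriv φ) := hφ.continuous_deriv le_rfl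
  have := pp_prob hKc h0
  have hG : Continuous fun x => deriv φ (f x) ^ 2 := by fun_prop
  set I := ∫ x, deriv φ (f x) ^ 2 ∂(unifOn K) with hI
  have hI0 : 0 ≤ I := integral_nonneg fun x => sq_nonneg _
  set ρ : Measure ℝ := volume.restrict (Set.Ioc 0 1) with hρ
  have hρ1 : ρ Set.univ = 1 := by simp [hρ]
  calc ∫⁻ x, ENNReal.ofReal ((φ (f x) - φ (f ((1 / 2 : ℝ) • (x + y)))) ^ 2) ∂(unifOn K)
      ≤ ∫⁻ x, ENNReal.ofReal (M ^ 2) * ∫⁻ t, ENNReal.ofReal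
          (deriv φ (f (y + (1 - t / 2) • (x - y))) ^ 2) ∂ρ ∂(unifOn K) := by
        refine lintegral_mono_ae ?_
        filter_upwards [pp_ae hKc] with x hx
        have hw : (1 / 2 : ℝ) • (x + y) ∈ K := by
          have := hK hx hy (a := 1/2) (b := 1/2) (by norm_num) (by norm_num) (by norm_num)
          rwa [smul_add]
        obtain ⟨q, hq, hqM⟩ := hM x hx _ hw
        have h := pp_path hφ x _ q M hq hqM
        have e : ∀ t : ℝ, x + t • ((1 / 2 : ℝ) • (x + y) - x) = y + (1 - t / 2) • (x - y) := by
          intro t; module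
        simp_rw [e] at h
        rw [← ofReal_integral_eq_lintegral_ofReal, ← ENNReal.ofReal_mul (sq_nonneg _)]
        · rw [intervalIntegral.integral_of_le (by norm_num)] at h
          exact ENNReal.ofReal_le_ofReal h
        · refine (Continuous.integrableOn_Icc ?_).mono_set Set.Ioc_subset_Icc_self
          fun_prop
        · exact ae_of_all _ fun t => sq_nonneg _
    _ = ENNReal.ofReal (M ^ 2) * ∫⁻ t, ∫⁻ x, ENNReal.ofReal
          (deriv φ (f (y + (1 - t / 2) • (x - y))) ^ 2) ∂(unifOn K) ∂ρ := by
        have hc : Continuous fun z : EuclideanSpace ℝ (Fin n) × ℝ =>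
            ENNReal.ofReal (deriv φ (f (y + (1 - z.2 / 2) • (z.1 - y))) ^ 2) := by
          refine ENNReal.continuous_ofReal.comp ?_
          fun_prop
        rw [lintegral_const_mul', lintegral_lintegral_swap]
        · exact hc.measurable.aemeasurable
        · exact ENNReal.ofReal_ne_top
    _ ≤ ENNReal.ofReal (M ^ 2) * ∫⁻ _t, ENNReal.ofReal (2 ^ n * I) ∂ρ := by
        refine mul_le_mul_right ?_ _
        refine lintegral_mono_ae ?_
        filter_upwards [ae_restrict_mem measurableSet_Ioc] with t ht
        have hs : (1 / 2 : ℝ) ≤ 1 - t / 2 := by linarith [ht.2]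
        have h := pp_dilate hK hKc hy (s := 1 - t / 2) (by linarith) (by linarith [ht.1])
          (fun x => ENNReal.ofReal (deriv φ (f x) ^ 2)) hG.measurable.ennreal_ofReal
        refine h.trans ?_
        rw [← ofReal_integral_eq_lintegral_ofReal (pp_int hKc h0 hG)
          (ae_of_all _ fun x => sq_nonneg _), ← ENNReal.ofReal_mul (by
            have : 0 < 1 - t / 2 := by linarith
            positivity)]
        refine ENNReal.ofReal_le_ofReal ?_
        gcongr
        rw [← inv_pow]
        have h2 : (1 - t / 2)⁻¹ ≤ 2 := by
          rw [inv_le_comm₀ (by linarith) (by norm_num)]; linarith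
        exact pow_le_pow_left₀ (inv_nonneg.2 (by linarith)) h2 n
    _ = _ := by
        rw [lintegral_const, hρ1, mul_one, ← ENNReal.ofReal_mul (sq_nonneg _)]
        congr 1; ring

lemma pp_var {n : ℕ} {K : Set (EuclideanSpace ℝ (Fin n))} (hK : Convex ℝ K)
    (hKc : IsCompact K) (h0 : volume K ≠ 0) {f : EuclideanSpace ℝ (Fin n) → ℝ}
    (hf : Continuous f) {φ : ℝ → ℝ} (hφ : ContDiff ℝ 1 φ) (M : ℝ)
    (hM : ∀ x ∈ K, ∀ w ∈ K, ∃ q : Polynomial ℝ, (∀ t : ℝ, q.eval t = f (x + t • (w - x))) ∧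
        ∀ t ∈ Set.Icc (0 : ℝ) 1, |q.derivative.eval t| ≤ M) :
    ∫ x, (φ (f x) - ∫ y, φ (f y) ∂(unifOn K)) ^ 2 ∂(unifOn K) ≤
      4 * (2 ^ n * M ^ 2 * ∫ x, deriv φ (f x) ^ 2 ∂(unifOn K)) := by
  have hp := pp_prob hKc h0
  have hφc : Continuous φ := hφ.continuous
  set I := ∫ x, deriv φ (f x) ^ 2 ∂(unifOn K) with hI
  have hI0 : 0 ≤ I := integral_nonneg fun x => sq_nonneg _
  set B := 2 ^ n * M ^ 2 * I with hB
  have hB0 : 0 ≤ B := by positivity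
  set F : EuclideanSpace ℝ (Fin n) → ℝ := fun x => φ (f x) with hF
  have hFc : Continuous F := by fun_prop
  set c := ∫ y, F y ∂(unifOn K) with hc
  set V := ∫ x, (F x - c) ^ 2 ∂(unifOn K) with hV
  -- pointwise
  have h1 : ∀ y, ∫ x, (F x - F y) ^ 2 ∂(unifOn K) = V + (F y - c) ^ 2 := by
    intro y
    have : ∀ x, (F x - F y) ^ 2 = (F x - c) ^ 2 - 2 * (F y - c) * (F x - c) + (F y - c) ^ 2 :=
      fun x => by ring
    simp_rw [this]
    rw [integral_add (pp_int hKc h0 (by fun_prop)) (pp_int hKc h0 (by fun_prop)),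
      integral_sub (pp_int hKc h0 (by fun_prop)) (pp_int hKc h0 (by fun_prop)),
      integral_const_mul, integral_sub (pp_int hKc h0 hFc) (integrable_const _)]
    simp [← hc, ← hV]
  have hVB : ENNReal.ofReal V ≤ ∫⁻ y, ∫⁻ x, ENNReal.ofReal ((F x - F y) ^ 2)
      ∂(unifOn K) ∂(unifOn K) := by
    calc ENNReal.ofReal V = ∫⁻ _y, ENNReal.ofReal V ∂(unifOn K) := by simp
      _ ≤ _ := by
        refine lintegral_mono fun y => ?_
        rw [← ofReal_integral_eq_lintegral_ofReal (pp_int hKc h0 (by fun_prop))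
          (ae_of_all _ fun x => sq_nonneg _), h1]
        exact ENNReal.ofReal_le_ofReal (by linarith [sq_nonneg (F y - c)])
  set H : EuclideanSpace ℝ (Fin n) → EuclideanSpace ℝ (Fin n) → ENNReal := fun x y =>
    ENNReal.ofReal ((F x - F ((1 / 2 : ℝ) • (x + y))) ^ 2) with hH
  have hHm : Measurable (Function.uncurry H) := by
    have : Continuous (Function.uncurry H) := by
      simp only [hH, Function.uncurry_def]
      refine ENNReal.continuous_ofReal.comp ?_
      fun_prop
    exact this.measurable
  have hHi : ∫⁻ y, ∫⁻ x, H x y ∂(unifOn K) ∂(unifOn K) ≤ ENNReal.ofReal B := by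
    calc _ ≤ ∫⁻ _y, ENNReal.ofReal B ∂(unifOn K) := by
          refine lintegral_mono_ae ?_
          filter_upwards [pp_ae hKc] with y hy
          exact pp_half hK hKc h0 hf hφ M hM hy
      _ = _ := by simp
  have hHi' : ∫⁻ y, ∫⁻ x, H y x ∂(unifOn K) ∂(unifOn K) ≤ ENNReal.ofReal B := by
    rw [lintegral_lintegral_swap hHm.aemeasurable]
    exact hHi
  have hpt : ∀ x y, ENNReal.ofReal ((F x - F y) ^ 2) ≤ 2 * H x y + 2 * H y x := by
    intro x y
    simp only [hH]
    rw [add_comm y x]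
    set a := F ((1 / 2 : ℝ) • (x + y))
    rw [show (2 : ENNReal) = ENNReal.ofReal 2 by simp,
      ← ENNReal.ofReal_mul (by norm_num), ← ENNReal.ofReal_mul (by norm_num),
      ← ENNReal.ofReal_add (by positivity) (by positivity)]
    exact ENNReal.ofReal_le_ofReal (by nlinarith [sq_nonneg ((F x - a) + (F y - a))])
  have hfin : ENNReal.ofReal V ≤ ENNReal.ofReal (4 * B) := by
    refine hVB.trans ?_
    calc _ ≤ ∫⁻ y, ∫⁻ x, (2 * H x y + 2 * H y x) ∂(unifOn K) ∂(unifOn K) :=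
          lintegral_mono fun y => lintegral_mono fun x => hpt x y
      _ = 2 * (∫⁻ y, ∫⁻ x, H x y ∂(unifOn K) ∂(unifOn K)) +
          2 * ∫⁻ y, ∫⁻ x, H y x ∂(unifOn K) ∂(unifOn K) := by
          have m1 : ∀ y, Measurable fun x => H x y := fun y =>
            hHm.comp (measurable_id.prodMk measurable_const)
          have m2 : Measurable fun y => ∫⁻ x, H x y ∂(unifOn K) :=
            Measurable.lintegral_prod_left' hHm
          rw [← lintegral_const_mul' _ _ (by simp), ← lintegral_const_mul' _ _ (by simp),
            ← lintegral_add_left (m2.const_mul _)]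
          refine lintegral_congr fun y => ?_
          rw [lintegral_add_left ((m1 y).const_mul _), lintegral_const_mul' _ _ (by simp),
            lintegral_const_mul' _ _ (by simp)]
      _ ≤ 2 * ENNReal.ofReal B + 2 * ENNReal.ofReal B := by gcongr
      _ = ENNReal.ofReal (4 * B) := by
          rw [show (2 : ENNReal) = ENNReal.ofReal 2 by simp,
            ← ENNReal.ofReal_mul (by norm_num),
            ← ENNReal.ofReal_add (by positivity) (by positivity)]
          congr 1; ring
  exact (ENNReal.ofReal_le_ofReal_iff (by positivity)).1 hfin

/-- Corollary 3.7 (Poincaré inequality): there is `C(d,n) > 0` such that for every convex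
compact `K ⊂ ℝ^n` of positive volume, every polynomial `f` of degree at most `d` with
`α_f > 0`, and every smooth `φ : ℝ → ℝ`,
`‖φ - ∫ φ dμ_f‖_{L²(μ_f)} ≤ C(d,n) α_f ‖φ'‖_{L²(μ_f)}`, where `μ_f = λ_K ∘ f⁻¹`. -/
theorem poincare_polynomial_image (d n : ℕ) :
    ∃ C : ℝ, 0 < C ∧
      ∀ K : Set (EuclideanSpace ℝ (Fin n)), Convex ℝ K → IsCompact K → volume K ≠ 0 →
        ∀ f : EuclideanSpace ℝ (Fin n) → ℝ, IsPolyDeg d f →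
          0 < ∫ x, |f x - ∫ y, f y ∂(unifOn K)| ∂(unifOn K) →
          ∀ φ : ℝ → ℝ, ContDiff ℝ (⊤ : ℕ∞) φ →
            Real.sqrt (∫ t, (φ t - ∫ u, φ u ∂((unifOn K).map f)) ^ 2 ∂((unifOn K).map f)) ≤
              C * (∫ x, |f x - ∫ y, f y ∂(unifOn K)| ∂(unifOn K)) *
                Real.sqrt (∫ t, (deriv φ t) ^ 2 ∂((unifOn K).map f)) := by
  obtain ⟨C, hC, hMk⟩ := pp_markov d n
  refine ⟨Real.sqrt (4 * 2 ^ n) * C, by positivity, ?_⟩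
  intro K hK hKc h0 f hf hα φ hφ
  have hfc := pp_cont hf
  have hφ1 : ContDiff ℝ 1 φ := hφ.of_le (by exact_mod_cast le_top)
  have hφc : Continuous φ := hφ1.continuous
  have hd : Continuous (deriv φ) := hφ1.continuous_deriv le_rfl
  set α := ∫ x, |f x - ∫ y, f y ∂(unifOn K)| ∂(unifOn K) with hαd
  have hv := pp_var hK hKc h0 hfc hφ1 (C * α)
    (fun x hx w hw => hMk K hK hKc h0 f hf (∫ y, f y ∂(unifOn K)) x hx w hw)
  rw [integral_map hfc.aemeasurable hφc.aestronglyMeasurable,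
    integral_map hfc.aemeasurable (Continuous.aestronglyMeasurable (by fun_prop)),
    integral_map hfc.aemeasurable (Continuous.aestronglyMeasurable (by fun_prop))]
  refine (Real.sqrt_le_sqrt hv).trans (le_of_eq ?_)
  rw [show ∀ I : ℝ, 4 * (2 ^ n * (C * α) ^ 2 * I) = (4 * 2 ^ n) * ((C * α) ^ 2 * I) from
    fun I => by ring, Real.sqrt_mul (by positivity), Real.sqrt_mul (sq_nonneg _),
    Real.sqrt_sq (by positivity)]
  ring
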